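/- arXiv:0912.0767 — 4 statements merged into one kernel-verified Lean document; each statement's English description precedes it below -/
import Mathlib

section
/- Let (L,A,δ) be a dg Loday pair, i.e., a Loday pair equipped with a square-zero degree +1 derivation δ = (δ_L, δ_A). Define derived brackets on the shifted pair (sL,sA) by [sx,sy]_d := (−1)^{|x|} s[δx, y] for x,y ∈ L, [sx,sa]_d := (−1)^{|x|} s[δx, a] for x ∈ L, a ∈ A, and [sa,sb]_d := (−1)^{|a|} s[δa, b] for a,b ∈ A. Then the triple of derived brackets provides a structure of Loday pair on (sL,sA): [,]_d is a Loday bracket on sL, an associative product on sA, and the mixed bracket satisfies the two derivation relations of a Loday pair. -/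
/-!
STATEMENT 8.  Let `(L, A, δ)` be a dg Loday pair, i.e. a graded (left) Loday
pair equipped with a square-zero degree `+1` derivation `δ = (δ_L, δ_A)`.
Define derived brackets on the shifted pair `(sL, sA)` by
`[sx,sy]_d := (-1)^{|x|} s[δx,y]`, `[sx,sa]_d := (-1)^{|x|} s[δx,a]`,
`[sa,sb]_d := (-1)^{|a|} s[δa,b]`.  Then the triple of derived brackets is a
structure of Loday pair on `(sL, sA)`: `[,]_d` is a Loday bracket on `sL`, an
associative product on `sA`, and the mixed bracket satisfies the two
derivation relations of a Loday pair (with the shifted degrees `|x| + 1`).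

Graded vector spaces are modelled as `K`-modules (`K` a field of
characteristic zero) with internal ℤ-gradings; the Koszul sign convention is
used.
-/

theorem neg_one_zpow_mul_self {K : Type*} [Field K] (i : ℤ) :
    (-1 : K) ^ i * (-1 : K) ^ i = 1 := by
  rw [← mul_zpow, neg_one_mul, neg_neg, one_zpow]

theorem neg_one_zpow_shifted_sign {K : Type*} [Field K] (i j : ℤ) :
    (-1 : K) ^ (i + 1 + j) * ((-1 : K) ^ i * (-1 : K) ^ (i + 1)) =
      (-1 : K) ^ i * (-1 : K) ^ j := by
  have h : (-1 : K) ≠ 0 := neg_ne_zero.mpr one_ne_zero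
  rw [zpow_add₀ h, zpow_add₀ h, zpow_one]
  linear_combination (-1 : K) ^ i * (-1 : K) ^ j * neg_one_zpow_mul_self (K := K) i

theorem dg_loday_pair_derived_brackets
    (K VL VA : Type*) [Field K] [CharZero K]
    [AddCommGroup VL] [Module K VL] [AddCommGroup VA] [Module K VA]
    (grL : ℤ → Submodule K VL) (grA : ℤ → Submodule K VA)
    (hgrL : DirectSum.IsInternal grL) (hgrA : DirectSum.IsInternal grA)
    -- the three multiplications of the Loday pair, all of degree 0
    (brL : VL →ₗ[K] VL →ₗ[K] VL)      -- the Loday bracket on L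
    (brM : VL →ₗ[K] VA →ₗ[K] VA)      -- the bracket L ⊗ A → A
    (mulA : VA →ₗ[K] VA →ₗ[K] VA)     -- the associative product on A
    (hbrL_mem : ∀ (i j : ℤ) (x y : VL), x ∈ grL i → y ∈ grL j → brL x y ∈ grL (i + j))
    (hbrM_mem : ∀ (i p : ℤ) (x : VL) (a : VA), x ∈ grL i → a ∈ grA p → brM x a ∈ grA (i + p))
    (hmulA_mem : ∀ (p q : ℤ) (a b : VA), a ∈ grA p → b ∈ grA q → mulA a b ∈ grA (p + q))
    -- the Loday pair axioms
    (hloday : ∀ (i j : ℤ) (x y z : VL), x ∈ grL i → y ∈ grL j →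
      brL x (brL y z) = brL (brL x y) z + ((-1 : K) ^ (i * j)) • brL y (brL x z))
    (hactL : ∀ (i j : ℤ) (x y : VL) (a : VA), x ∈ grL i → y ∈ grL j →
      brM x (brM y a) = brM (brL x y) a + ((-1 : K) ^ (i * j)) • brM y (brM x a))
    (hactA : ∀ (i p : ℤ) (x : VL) (a b : VA), x ∈ grL i → a ∈ grA p →
      brM x (mulA a b) = mulA (brM x a) b + ((-1 : K) ^ (i * p)) • mulA a (brM x b))
    (hassocA : ∀ a b c : VA, mulA (mulA a b) c = mulA a (mulA b c))
    -- the differential: a square-zero degree `+1` derivation of the Loday pair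
    (δL : VL →ₗ[K] VL) (δA : VA →ₗ[K] VA)
    (hδL_mem : ∀ (i : ℤ) (x : VL), x ∈ grL i → δL x ∈ grL (i + 1))
    (hδA_mem : ∀ (p : ℤ) (a : VA), a ∈ grA p → δA a ∈ grA (p + 1))
    (hδ_brL : ∀ (i : ℤ) (x y : VL), x ∈ grL i →
      δL (brL x y) = brL (δL x) y + ((-1 : K) ^ i) • brL x (δL y))
    (hδ_brM : ∀ (i : ℤ) (x : VL) (a : VA), x ∈ grL i →
      δA (brM x a) = brM (δL x) a + ((-1 : K) ^ i) • brM x (δA a))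
    (hδ_mulA : ∀ (p : ℤ) (a b : VA), a ∈ grA p →
      δA (mulA a b) = mulA (δA a) b + ((-1 : K) ^ p) • mulA a (δA b))
    (hδδL : ∀ x : VL, δL (δL x) = 0) (hδδA : ∀ a : VA, δA (δA a) = 0)
    -- the derived brackets (`i` = degree of the first argument)
    (dbrL : ℤ → VL → VL → VL) (dbrM : ℤ → VL → VA → VA) (dmul : ℤ → VA → VA → VA)
    (hdbrL : ∀ (i : ℤ) (x y : VL), dbrL i x y = ((-1 : K) ^ i) • brL (δL x) y)
    (hdbrM : ∀ (i : ℤ) (x : VL) (a : VA), dbrM i x a = ((-1 : K) ^ i) • brM (δL x) a)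
    (hdmul : ∀ (p : ℤ) (a b : VA), dmul p a b = ((-1 : K) ^ p) • mulA (δA a) b) :
    -- the derived brackets form a Loday pair on the shifted pair `(sL, sA)`,
    -- with shifted degrees `|x| + 1`:
    -- (1) `[,]_d` is a Loday bracket on `sL`
    (∀ (i j k : ℤ) (x y z : VL), x ∈ grL i → y ∈ grL j → z ∈ grL k →
      dbrL i x (dbrL j y z) =
        dbrL (i + 1 + j) (dbrL i x y) z +
          ((-1 : K) ^ ((i + 1) * (j + 1))) • dbrL j y (dbrL i x z)) ∧
    -- (2) the first mixed derivation relation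
    (∀ (i j p : ℤ) (x y : VL) (a : VA), x ∈ grL i → y ∈ grL j → a ∈ grA p →
      dbrM i x (dbrM j y a) =
        dbrM (i + 1 + j) (dbrL i x y) a +
          ((-1 : K) ^ ((i + 1) * (j + 1))) • dbrM j y (dbrM i x a)) ∧
    -- (3) the second mixed derivation relation
    (∀ (i p q : ℤ) (x : VL) (a b : VA), x ∈ grL i → a ∈ grA p → b ∈ grA q →
      dbrM i x (dmul p a b) =
        dmul (i + 1 + p) (dbrM i x a) b +
          ((-1 : K) ^ ((i + 1) * (p + 1))) • dmul p a (dbrM i x b)) ∧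
    -- (4) the derived product is associative on `sA`
    (∀ (p q s : ℤ) (a b c : VA), a ∈ grA p → b ∈ grA q → c ∈ grA s →
      dmul (p + 1 + q) (dmul p a b) c = dmul p a (dmul q b c)) := by
  refine ⟨?_, ?_, ?_, ?_⟩
  · intro i j k x y z hx hy _
    simp only [hdbrL, map_smul, LinearMap.smul_apply, hδ_brL _ _ _ (hδL_mem _ _ hx), hδδL,
      map_zero, LinearMap.zero_apply, zero_add,
      hloday _ _ _ _ z (hδL_mem _ _ hx) (hδL_mem _ _ hy), smul_add, smul_smul,
      neg_one_zpow_shifted_sign]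
    congr 2
    ring
  · intro i j p x y a hx hy _
    simp only [hdbrM, hdbrL, map_smul, LinearMap.smul_apply, hδ_brL _ _ _ (hδL_mem _ _ hx), hδδL,
      map_zero, LinearMap.zero_apply, zero_add,
      hactL _ _ _ _ a (hδL_mem _ _ hx) (hδL_mem _ _ hy), smul_add, smul_smul,
      neg_one_zpow_shifted_sign]
    congr 2
    ring
  · intro i p q x a b hx ha _
    simp only [hdbrM, hdmul, map_smul, LinearMap.smul_apply, hδ_brM _ _ _ (hδL_mem _ _ hx), hδδL,
      map_zero, LinearMap.zero_apply, zero_add,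
      hactA _ _ _ _ b (hδL_mem _ _ hx) (hδA_mem _ _ ha), smul_add, smul_smul,
      neg_one_zpow_shifted_sign]
    congr 2
    ring
  · intro p q s a b c ha _ _
    simp only [hdmul, map_smul, LinearMap.smul_apply, hδ_mulA _ _ _ (hδA_mem _ _ ha), hδδA,
      map_zero, LinearMap.zero_apply, zero_add, hassocA, smul_smul, neg_one_zpow_shifted_sign]
end

section
/- Let (A,*,d) be a differential graded associative algebra (d a square-zero degree +1 derivation of the associative product *). Define the derived product a *_d b := (−1)^{|a|}(da)*b. Then *_d is associative: (a *_d b) *_d c = a *_d (b *_d c) for all homogeneous a, b, c ∈ A. -/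
/-!
STATEMENT 13.  Let `(A, *, d)` be a differential graded associative algebra
(`d` a square-zero degree `+1` derivation of the associative product `*`).
Define the derived product `a *_d b := (-1)^{|a|} (d a) * b`.  Then `*_d` is
associative on homogeneous elements.

A graded vector space over a field `K` of characteristic zero is modelled as a
`K`-module `V` together with an internal ℤ-grading `gr : ℤ → Submodule K V`
(`DirectSum.IsInternal gr`); homogeneous elements of degree `i` are the members
of `gr i`.  The Koszul sign convention is used throughout.
-/

theorem derived_product_associative
    (K V : Type*) [Field K] [CharZero K] [AddCommGroup V] [Module K V]
    (gr : ℤ → Submodule K V) (hgr : DirectSum.IsInternal gr)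
    -- the associative product, of degree 0
    (mul : V →ₗ[K] V →ₗ[K] V)
    (hmul_mem : ∀ (i j : ℤ) (a b : V), a ∈ gr i → b ∈ gr j → mul a b ∈ gr (i + j))
    (hassoc : ∀ a b c : V, mul (mul a b) c = mul a (mul b c))
    -- the differential: a square-zero degree `+1` derivation
    (d : V →ₗ[K] V)
    (hd_mem : ∀ (i : ℤ) (a : V), a ∈ gr i → d a ∈ gr (i + 1))
    (hleib : ∀ (i : ℤ) (a b : V), a ∈ gr i →
      d (mul a b) = mul (d a) b + ((-1 : K) ^ i) • mul a (d b))
    (hdd : ∀ a : V, d (d a) = 0)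
    -- the derived product on homogeneous elements (`i` = degree of the first argument)
    (dp : ℤ → V → V → V)
    (hdp : ∀ (i : ℤ) (a b : V), dp i a b = ((-1 : K) ^ i) • mul (d a) b)
    -- homogeneous elements `a, b, c`
    (i j k : ℤ) (a b c : V) (ha : a ∈ gr i) (hb : b ∈ gr j) (hc : c ∈ gr k) :
    dp (i + 1 + j) (dp i a b) c = dp i a (dp j b c) := by
  have hsq : ((-1 : K) ^ i) * ((-1 : K) ^ i) = 1 := by
    rw [← mul_zpow]; simp
  have hne : (-1 : K) ≠ 0 := by simp
  simp only [hdp, map_smul, LinearMap.smul_apply, hleib (i + 1) (d a) b (hd_mem i a ha), hdd,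
    map_zero, LinearMap.zero_apply, zero_add, hassoc, smul_smul, zpow_add₀ hne, zpow_one]
  congr 1
  linear_combination ((-1 : K) ^ i * (-1 : K) ^ j) * hsq
end

section
/- Let (𝔤, d, [,]) be a differential graded Lie algebra. Define the derived bracket [x,y]_d := (−1)^{|x|}[dx, y]. Then the derived bracket satisfies the graded Leibniz identity with respect to the shifted degree: [x,[y,z]_d]_d = [[x,y]_d, z]_d + (−1)^{(|x|+1)(|y|+1)}[y,[x,z]_d]_d for all homogeneous x, y, z ∈ 𝔤; that is, (s𝔤, [,]_d) is a graded (left) Loday algebra. -/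
/-!
STATEMENT 14.  Let `(𝔤, d, [,])` be a differential graded Lie algebra.  Define
the derived bracket `[x,y]_d := (-1)^{|x|} [d x, y]`.  Then the derived bracket
satisfies the graded Leibniz identity with respect to the shifted degree:
`[x,[y,z]_d]_d = [[x,y]_d, z]_d + (-1)^{(|x|+1)(|y|+1)} [y,[x,z]_d]_d`,
i.e. `(s𝔤, [,]_d)` is a graded (left) Loday algebra.

The graded vector space `𝔤` is modelled as a `K`-module `V` (`K` a field of
characteristic zero) with an internal ℤ-grading `gr`; the Koszul sign
convention is used.
-/

theorem derived_bracket_loday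
    (K V : Type*) [Field K] [CharZero K] [AddCommGroup V] [Module K V]
    (gr : ℤ → Submodule K V) (hgr : DirectSum.IsInternal gr)
    -- the graded Lie bracket, of degree 0
    (br : V →ₗ[K] V →ₗ[K] V)
    (hbr_mem : ∀ (i j : ℤ) (x y : V), x ∈ gr i → y ∈ gr j → br x y ∈ gr (i + j))
    (hantisym : ∀ (i j : ℤ) (x y : V), x ∈ gr i → y ∈ gr j →
      br x y = -((-1 : K) ^ (i * j)) • br y x)
    (hjacobi : ∀ (i j : ℤ) (x y z : V), x ∈ gr i → y ∈ gr j →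
      br x (br y z) = br (br x y) z + ((-1 : K) ^ (i * j)) • br y (br x z))
    -- the differential: a square-zero degree `+1` derivation of the bracket
    (d : V →ₗ[K] V)
    (hd_mem : ∀ (i : ℤ) (x : V), x ∈ gr i → d x ∈ gr (i + 1))
    (hleib : ∀ (i : ℤ) (x y : V), x ∈ gr i →
      d (br x y) = br (d x) y + ((-1 : K) ^ i) • br x (d y))
    (hdd : ∀ x : V, d (d x) = 0)
    -- the derived bracket on homogeneous elements (`i` = degree of the first argument)
    (db : ℤ → V → V → V)
    (hdb : ∀ (i : ℤ) (x y : V), db i x y = ((-1 : K) ^ i) • br (d x) y)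
    -- homogeneous elements `x, y, z`
    (i j k : ℤ) (x y z : V) (hx : x ∈ gr i) (hy : y ∈ gr j) (hz : z ∈ gr k) :
    db i x (db j y z) =
      db (i + 1 + j) (db i x y) z + ((-1 : K) ^ ((i + 1) * (j + 1))) • db j y (db i x z) := by
  have hsq : ((-1 : K) ^ i) * ((-1 : K) ^ i) = 1 := by
    rw [← mul_zpow]; simp
  have hne : (-1 : K) ≠ 0 := neg_ne_zero.mpr one_ne_zero
  -- `d [x,y]_d = -[dx, dy]`
  have hd : d (((-1 : K) ^ i) • br (d x) y) = -br (d x) (d y) := by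
    rw [map_smul, hleib (i + 1) (d x) y (hd_mem i x hx), hdd, map_zero, LinearMap.zero_apply,
      zero_add, smul_smul, zpow_add_one₀ hne, ← mul_assoc, hsq, one_mul, neg_one_smul]
  simp only [hdb]
  rw [hd, map_neg, LinearMap.neg_apply, map_smul, map_smul,
    hjacobi (i + 1) (j + 1) (d x) (d y) z (hd_mem i x hx) (hd_mem j y hy),
    zpow_add₀ hne (i + 1) j, zpow_add_one₀ hne]
  module
end

section
/- Let (G, ∧, [,]) be a Gerstenhaber algebra (graded Poisson algebra of type (−1,0), e.g., the multivector fields Γ⋀^•TM with wedge product and Schouten–Nijenhuis bracket) and let π ∈ G be an element of degree 2 satisfying the Maurer–Cartan equation [π,π] = 0. Then d := [π,−] is a square-zero degree +1 derivation of both ∧ and [,], and the derived bracket [X,Y]_π := (−1)^{|X|}[dX, Y] together with the product ∧ makes the self pair (G, G) a graded Loday pair: [,]_π satisfies the graded Leibniz identity, and [X, Y∧Z]_π = [X,Y]_π ∧ Z + (−1)^{(|X|+1)|Y|} Y ∧ [X,Z]_π for all homogeneous X, Y, Z ∈ G. -/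
/-!
STATEMENT 16.  Let `(G, ∧, [,])` be a Gerstenhaber algebra (graded Poisson
algebra of type `(-1,0)`) and `π ∈ G` of degree `2` with `[π,π] = 0`.  Then
`d := [π,-]` is a square-zero degree `+1` derivation of both `∧` and `[,]`,
and the derived bracket `[X,Y]_π := (-1)^{|X|} [dX, Y]` together with `∧`
makes the self pair `(G,G)` a graded Loday pair: `[,]_π` satisfies the graded
Leibniz identity, and the mixed derivation relation
`[X, Y∧Z]_π = [X,Y]_π ∧ Z + (-1)^{(|X|+1)|Y|} Y ∧ [X,Z]_π` holds, where in the
Loday-pair signs the degree of a Loday-side element `X` is the *shifted*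
degree `|X|+1` (below, `X ∈ gr i` has shifted degree `i + 1`, so the signs in
the last two identities are `(-1)^{((i+1)+1)((j+1)+1)}` and `(-1)^{((i+1)+1)j}`).

The graded vector space `G` is modelled as a `K`-module `V` (`K` a field of
characteristic zero) with an internal ℤ-grading `gr`; the Koszul sign
convention is used.
-/

theorem neg_one_zpow_congr {K : Type*} [Field K] {m n : ℤ} (h : Even (m - n)) :
    (-1 : K) ^ m = (-1 : K) ^ n := by
  rw [← sub_add_cancel m n, zpow_add₀ (by simp), h.neg_one_zpow, one_mul]

theorem gerstenhaber_maurer_cartan_loday_pair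
    (K V : Type*) [Field K] [CharZero K] [AddCommGroup V] [Module K V]
    (gr : ℤ → Submodule K V) (hgr : DirectSum.IsInternal gr)
    -- the graded commutative associative product `∧`, of degree 0
    (wedge : V →ₗ[K] V →ₗ[K] V)
    (hw_mem : ∀ (i j : ℤ) (a b : V), a ∈ gr i → b ∈ gr j → wedge a b ∈ gr (i + j))
    (hw_assoc : ∀ a b c : V, wedge (wedge a b) c = wedge a (wedge b c))
    (hw_comm : ∀ (i j : ℤ) (a b : V), a ∈ gr i → b ∈ gr j →
      wedge a b = ((-1 : K) ^ (i * j)) • wedge b a)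
    -- the Gerstenhaber bracket, of degree `-1` (a graded Lie bracket on the shifted space)
    (br : V →ₗ[K] V →ₗ[K] V)
    (hbr_mem : ∀ (i j : ℤ) (a b : V), a ∈ gr i → b ∈ gr j → br a b ∈ gr (i + j - 1))
    (hbr_antisym : ∀ (i j : ℤ) (a b : V), a ∈ gr i → b ∈ gr j →
      br a b = -((-1 : K) ^ ((i - 1) * (j - 1))) • br b a)
    (hbr_jacobi : ∀ (i j : ℤ) (a b c : V), a ∈ gr i → b ∈ gr j →
      br a (br b c) = br (br a b) c + ((-1 : K) ^ ((i - 1) * (j - 1))) • br b (br a c))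
    -- `[X,-]` is a derivation of `∧` of degree `|X| - 1`
    (hpoisson : ∀ (i j : ℤ) (a b c : V), a ∈ gr i → b ∈ gr j →
      br a (wedge b c) = wedge (br a b) c + ((-1 : K) ^ ((i - 1) * j)) • wedge b (br a c))
    -- the Maurer–Cartan element
    (π : V) (hπ : π ∈ gr 2) (hmc : br π π = 0)
    -- the induced differential `d := [π,-]` and the derived bracket
    (d : V → V) (hd : ∀ a, d a = br π a)
    (db : ℤ → V → V → V)
    (hdb : ∀ (i : ℤ) (X Y : V), db i X Y = ((-1 : K) ^ i) • br (d X) Y) :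
    -- (a)  `d` is a square-zero degree `+1` derivation of both `∧` and `[,]`
    (∀ (i : ℤ) (a : V), a ∈ gr i → d a ∈ gr (i + 1)) ∧
    (∀ a : V, d (d a) = 0) ∧
    (∀ (i : ℤ) (a b : V), a ∈ gr i →
      d (wedge a b) = wedge (d a) b + ((-1 : K) ^ i) • wedge a (d b)) ∧
    (∀ (i : ℤ) (a b : V), a ∈ gr i →
      d (br a b) = br (d a) b + ((-1 : K) ^ (i + 1)) • br a (d b)) ∧
    -- (b)  the derived bracket satisfies the graded Leibniz (Loday) identity,
    --      with shifted degrees `|X| + 1`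
    (∀ (i j k : ℤ) (X Y Z : V), X ∈ gr i → Y ∈ gr j → Z ∈ gr k →
      db i X (db j Y Z) =
        db (i + j) (db i X Y) Z +
          ((-1 : K) ^ (((i + 1) + 1) * ((j + 1) + 1))) • db j Y (db i X Z)) ∧
    -- (c)  the mixed Loday-pair derivation relation with respect to `∧`
    (∀ (i j k : ℤ) (X Y Z : V), X ∈ gr i → Y ∈ gr j → Z ∈ gr k →
      db i X (wedge Y Z) =
        wedge (db i X Y) Z + ((-1 : K) ^ (((i + 1) + 1) * j)) • wedge Y (db i X Z)) := by
  have d_mem (i : ℤ) (a : V) (ha : a ∈ gr i) : d a ∈ gr (i + 1) := by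
    have h := hbr_mem 2 i π a hπ ha
    rwa [show (2 : ℤ) + i - 1 = i + 1 by ring, ← hd] at h
  have d_d (a : V) : d (d a) = 0 := by
    have h := hbr_jacobi 2 2 π π a hπ hπ
    norm_num [hmc] at h
    rw [hd, hd]
    have := IsAddTorsionFree.of_isTorsionFree K V
    exact self_eq_neg.mp h
  have d_br (i : ℤ) (a b : V) (ha : a ∈ gr i) :
      d (br a b) = br (d a) b + ((-1 : K) ^ (i + 1)) • br a (d b) := by
    rw [hd, hd, hd, hbr_jacobi 2 i π a b hπ ha,
      neg_one_zpow_congr (n := i + 1) ⟨-1, by ring⟩]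
  refine ⟨d_mem, d_d, fun i a b ha => ?_, d_br, fun i j k X Y Z hX hY _ => ?_,
    fun i j k X Y Z hX hY _ => ?_⟩
  · rw [hd, hd, hd, hpoisson 2 i π a b hπ ha, neg_one_zpow_congr (n := i) ⟨0, by ring⟩]
  · have hdX := d_mem i X hX
    have hdY := d_mem j Y hY
    have d_smul (c : K) (a : V) : d (c • a) = c • d a := by simp only [hd, map_smul]
    have hsq : (-1 : K) ^ i * (-1 : K) ^ i = 1 := by
      rw [← mul_zpow]
      simp
    have h_deriv : (-1 : K) ^ i • d (br (d X) Y) = br (d X) (d Y) := by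
      rw [d_br (i + 1) (d X) Y hdX, d_d, map_zero, LinearMap.zero_apply, zero_add,
        neg_one_zpow_congr (m := i + 1 + 1) (n := i) ⟨1, by ring⟩, smul_smul, hsq, one_smul]
    have hsign : (-1 : K) ^ ((i + 1 + 1) * (j + 1 + 1)) = (-1 : K) ^ ((i + 1 - 1) * (j + 1 - 1)) :=
      neg_one_zpow_congr ⟨i + j + 2, by ring⟩
    simp only [hdb]
    rw [d_smul, h_deriv, map_smul, map_smul, hbr_jacobi (i + 1) (j + 1) _ _ Z hdX hdY, hsign,
      zpow_add₀ (by simp : (-1 : K) ≠ 0) i j]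
    module
  · have hsign : (-1 : K) ^ ((i + 1 + 1) * j) = (-1 : K) ^ ((i + 1 - 1) * j) :=
      neg_one_zpow_congr ⟨j, by ring⟩
    simp only [hdb]
    rw [hpoisson (i + 1) j _ Y Z (d_mem i X hX) hY, hsign, map_smul, map_smul,
      LinearMap.smul_apply]
    module
end
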